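/- If Z is an ALCι_G bisimulation between interpretations I and J and (d,e) ∈ Z, then for every ALCι_G concept C, d ∈ C^I if and only if e ∈ C^J; that is, (I,d) ∼_{ALCι_G} (J,e) implies (I,d) ≡_{ALCι_G} (J,e). -/

import Mathlib

universe u v

namespace DL

/-- ALCι concepts, with atomic concept names and role names both drawn from
the countably infinite (and disjoint, being distinct sorts) sets `ℕ`. -/
inductive Concept : Type
  | atom : ℕ → Concept
  | neg : Concept → Concept
  | conj : Concept → Concept → Concept
  | ex : ℕ → Concept → Concept
  | iotaL : Concept → Concept
  | iotaG : Concept → Concept → Concept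
  deriving DecidableEq

/-- An interpretation with (nonempty) domain `D`. -/
structure Interp (D : Type u) where
  atomI : ℕ → Set D
  roleI : ℕ → Set (D × D)

/-- The extension `C^I` of a concept `C` in the interpretation `I`. -/
def Interp.sem {D : Type u} (I : Interp D) : Concept → Set D
  | .atom A => I.atomI A
  | .neg C => (I.sem C)ᶜ
  | .conj C D' => I.sem C ∩ I.sem D'
  | .ex r C => {d | ∃ e, (d, e) ∈ I.roleI r ∧ e ∈ I.sem C}
  | .iotaL C => {d | I.sem C = {d}}
  | .iotaG C D' => {_d | ∃ e, I.sem C = {e} ∧ e ∈ I.sem D'}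

/-- Concepts not using the global definite description constructor `ιC.D`,
i.e. ALCι_L concepts. -/
def Concept.noG : Concept → Prop
  | .atom _ => True
  | .neg C => C.noG
  | .conj C D => C.noG ∧ D.noG
  | .ex _ C => C.noG
  | .iotaL C => C.noG
  | .iotaG _ _ => False

/-- Concepts not using the local definite description constructor `{ιC}`,
i.e. ALCι_G concepts. -/
def Concept.noL : Concept → Prop
  | .atom _ => True
  | .neg C => C.noL
  | .conj C D => C.noL ∧ D.noL
  | .ex _ C => C.noL
  | .iotaL _ => False
  | .iotaG C D => C.noL ∧ D.noL

/-- ALC concepts: neither local nor global definite descriptions. -/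
def Concept.isALC (C : Concept) : Prop := C.noG ∧ C.noL

/-- Condition (Atom) for a relation `Z ⊆ Δ^I × Δ^J`. -/
def AtomCond {D : Type u} {E : Type v} (I : Interp D) (J : Interp E) (Z : Set (D × E)) : Prop :=
  ∀ p ∈ Z, ∀ A : ℕ, p.1 ∈ I.atomI A ↔ p.2 ∈ J.atomI A

/-- Condition (Forth). -/
def ForthCond {D : Type u} {E : Type v} (I : Interp D) (J : Interp E) (Z : Set (D × E)) : Prop :=
  ∀ p ∈ Z, ∀ r : ℕ, ∀ d' : D, (p.1, d') ∈ I.roleI r →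
    ∃ e' : E, (p.2, e') ∈ J.roleI r ∧ (d', e') ∈ Z

/-- Condition (Back). -/
def BackCond {D : Type u} {E : Type v} (I : Interp D) (J : Interp E) (Z : Set (D × E)) : Prop :=
  ∀ p ∈ Z, ∀ r : ℕ, ∀ e' : E, (p.2, e') ∈ J.roleI r →
    ∃ d' : D, (p.1, d') ∈ I.roleI r ∧ (d', e') ∈ Z

/-- `Names(Δ', I)`: the set of ALC concepts whose extension in `I` is a
singleton `{d}` with `d ∈ Δ'`. -/
def Names {D : Type u} (Δ' : Set D) (I : Interp D) : Set Concept :=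
  {C | C.isALC ∧ ∃ d ∈ Δ', I.sem C = {d}}

/-- The domain of a relation. -/
def Dom {D : Type u} {E : Type v} (Z : Set (D × E)) : Set D := {d | ∃ e, (d, e) ∈ Z}

/-- The range of a relation. -/
def Rng {D : Type u} {E : Type v} (Z : Set (D × E)) : Set E := {e | ∃ d, (d, e) ∈ Z}

/-- ALCι_L bisimulations between `I` and `J`. -/
def IsBisimL {D : Type u} {E : Type v} (I : Interp D) (J : Interp E) (Z : Set (D × E)) : Prop :=
  Z = ∅ ∨ (AtomCond I J Z ∧ ForthCond I J Z ∧ BackCond I J Z ∧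
    Names (Dom Z) I = Names (Rng Z) J)

/-- ALCι_G bisimulations between `I` and `J`. -/
def IsBisimG {D : Type u} {E : Type v} (I : Interp D) (J : Interp E) (Z : Set (D × E)) : Prop :=
  Z = ∅ ∨ (AtomCond I J Z ∧ ForthCond I J Z ∧ BackCond I J Z ∧
    Names (Set.univ : Set D) I = Names (Set.univ : Set E) J)

/-- ALC bisimulations between `I` and `J`. -/
def IsBisimALC {D : Type u} {E : Type v} (I : Interp D) (J : Interp E) (Z : Set (D × E)) : Prop :=
  AtomCond I J Z ∧ ForthCond I J Z ∧ BackCond I J Z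

/-- The maximal ALC bisimulation between `I` and `J`: the union of all ALC
bisimulations between them. -/
def maxBisimALC {D : Type u} {E : Type v} (I : Interp D) (J : Interp E) : Set (D × E) :=
  ⋃₀ {Z | IsBisimALC I J Z}

/-- `NamedInd(Δ', I)`: the named individuals of `Δ'`. -/
def NamedInd {D : Type u} (Δ' : Set D) (I : Interp D) : Set D :=
  {d ∈ Δ' | ∃ C ∈ Names Δ' I, d ∈ I.sem C}

/-- A relation `Z` is total over `X × Y`. -/
def TotalOver {D : Type u} {E : Type v} (Z : Set (D × E)) (X : Set D) (Y : Set E) : Prop :=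
  (∀ x ∈ X, ∃ y ∈ Y, (x, y) ∈ Z) ∧ (∀ y ∈ Y, ∃ x ∈ X, (x, y) ∈ Z)

theorem mem_names_univ_iff {D : Type u} {I : Interp D} {C : Concept} :
    C ∈ Names Set.univ I ↔ C.isALC ∧ ∃ d, I.sem C = {d} := by
  simp [Names]

/-- The global description `ιC.D` holds iff both `C` and `C ⊓ D` are singletons. -/
theorem Interp.exists_sem_eq_singleton_and_mem_iff {D : Type u} (I : Interp D) (C C' : Concept) :
    (∃ d, I.sem C = {d} ∧ d ∈ I.sem C') ↔
      (∃ d, I.sem C = {d}) ∧ ∃ d, I.sem (.conj C C') = {d} := by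
  constructor
  · rintro ⟨d, hd, hd'⟩
    exact ⟨⟨d, hd⟩, d, by simpa [Interp.sem, hd] using hd'⟩
  · rintro ⟨⟨d, hd⟩, x, hx⟩
    have hmem : x ∈ I.sem C ∩ I.sem C' := by
      change x ∈ I.sem (.conj C C')
      simp [hx]
    obtain rfl : x = d := by simpa [hd] using hmem.1
    exact ⟨x, hd, hmem.2⟩

/-- Interpretations naming the same ALC concepts admit a common translation of each ALCι_G concept
to an ALC concept. -/
theorem exists_isALC_sem_eq {D : Type u} {E : Type v} {I : Interp D} {J : Interp E}
    (hN : Names (Set.univ : Set D) I = Names (Set.univ : Set E) J) (C : Concept) (hC : C.noL) :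
    ∃ C' : Concept, C'.isALC ∧ I.sem C' = I.sem C ∧ J.sem C' = J.sem C := by
  induction C with
  | atom A => exact ⟨.atom A, ⟨trivial, trivial⟩, rfl, rfl⟩
  | neg C ih =>
    obtain ⟨C', h, hI, hJ⟩ := ih hC
    exact ⟨.neg C', h, by simp [Interp.sem, hI], by simp [Interp.sem, hJ]⟩
  | conj C₁ C₂ ih₁ ih₂ =>
    obtain ⟨C₁', h₁, hI₁, hJ₁⟩ := ih₁ hC.1
    obtain ⟨C₂', h₂, hI₂, hJ₂⟩ := ih₂ hC.2
    exact ⟨.conj C₁' C₂', ⟨⟨h₁.1, h₂.1⟩, h₁.2, h₂.2⟩, by simp [Interp.sem, hI₁, hI₂],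
      by simp [Interp.sem, hJ₁, hJ₂]⟩
  | ex r C ih =>
    obtain ⟨C', h, hI, hJ⟩ := ih hC
    exact ⟨.ex r C', h, by simp [Interp.sem, hI], by simp [Interp.sem, hJ]⟩
  | iotaL C => exact hC.elim
  | iotaG C₁ C₂ ih₁ ih₂ =>
    obtain ⟨C₁', h₁, hI₁, hJ₁⟩ := ih₁ hC.1
    obtain ⟨C₂', h₂, hI₂, hJ₂⟩ := ih₂ hC.2
    have singleton_iff (K : Concept) (hK : K.isALC) :
        (∃ d, I.sem K = {d}) ↔ ∃ e, J.sem K = {e} := by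
      have h : K ∈ Names Set.univ I ↔ K ∈ Names Set.univ J := by rw [hN]
      simpa [mem_names_univ_iff, hK] using h
    have hiff : (∃ d, I.sem C₁ = {d} ∧ d ∈ I.sem C₂) ↔ ∃ e, J.sem C₁ = {e} ∧ e ∈ J.sem C₂ := by
      rw [← hI₁, ← hI₂, ← hJ₁, ← hJ₂, I.exists_sem_eq_singleton_and_mem_iff,
        J.exists_sem_eq_singleton_and_mem_iff, singleton_iff C₁' h₁,
        singleton_iff (.conj C₁' C₂') ⟨⟨h₁.1, h₂.1⟩, h₁.2, h₂.2⟩]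
    by_cases hJ : ∃ e, J.sem C₁ = {e} ∧ e ∈ J.sem C₂
    · have hI := hiff.2 hJ
      exact ⟨.neg (.conj (.atom 0) (.neg (.atom 0))), by simp [Concept.isALC, Concept.noG,
        Concept.noL], by simp only [Interp.sem, hI]; simp, by simp only [Interp.sem, hJ]; simp⟩
    · have hI := mt hiff.1 hJ
      exact ⟨.conj (.atom 0) (.neg (.atom 0)), by simp [Concept.isALC, Concept.noG,
        Concept.noL], by simp only [Interp.sem, hI]; simp, by simp only [Interp.sem, hJ]; simp⟩

/-- ALC concepts are invariant under ALC bisimulations. -/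
theorem IsBisimALC.mem_sem_iff {D : Type u} {E : Type v} {I : Interp D} {J : Interp E}
    {Z : Set (D × E)} (hZ : IsBisimALC I J Z) {C : Concept} (hC : C.isALC) {d : D} {e : E}
    (hde : (d, e) ∈ Z) : d ∈ I.sem C ↔ e ∈ J.sem C := by
  obtain ⟨hatom, hforth, hback⟩ := hZ
  induction C generalizing d e with
  | atom A => exact hatom _ hde A
  | neg C ih => exact not_congr (ih hC hde)
  | conj C₁ C₂ ih₁ ih₂ =>
    exact and_congr (ih₁ ⟨hC.1.1, hC.2.1⟩ hde) (ih₂ ⟨hC.1.2, hC.2.2⟩ hde)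
  | ex r C ih =>
    constructor
    · rintro ⟨d', hr, hd'⟩
      obtain ⟨e', hr', hz⟩ := hforth _ hde r d' hr
      exact ⟨e', hr', (ih hC hz).1 hd'⟩
    · rintro ⟨e', hr, he'⟩
      obtain ⟨d', hr', hz⟩ := hback _ hde r e' hr
      exact ⟨d', hr', (ih hC hz).2 he'⟩
  | iotaL C => exact hC.2.elim
  | iotaG C₁ C₂ => exact hC.1.elim

/-- if `Z` is an ALCι_G bisimulation between `I` and `J` and
`(d,e) ∈ Z`, then `d` and `e` satisfy the same ALCι_G concepts; that is,
`(I,d) ∼_{ALCι_G} (J,e)` implies `(I,d) ≡_{ALCι_G} (J,e)`. -/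
theorem stmt3 {D : Type u} {E : Type v} [Nonempty D] [Nonempty E]
    (I : Interp D) (J : Interp E) (Z : Set (D × E)) (hZ : IsBisimG I J Z)
    (d : D) (e : E) (hde : (d, e) ∈ Z) :
    ∀ C : Concept, C.noL → (d ∈ I.sem C ↔ e ∈ J.sem C) := by
  intro C hC
  rcases hZ with rfl | ⟨hatom, hforth, hback, hN⟩
  · exact hde.elim
  · obtain ⟨C', hC', hI, hJ⟩ := exists_isALC_sem_eq hN C hC
    rw [← hI, ← hJ]
    exact IsBisimALC.mem_sem_iff ⟨hatom, hforth, hback⟩ hC' hde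

end DL
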